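/- arXiv:1512.04971 — 8 statements merged into one kernel-verified Lean document; each statement's English description precedes it below -/
import Mathlib

section
/- Let d ≥ 1 and ã > 0. Let g̃₁, …, g̃_d be vectors in ℝ^d whose Gram matrix is given by g̃ᵢ · g̃ᵢ = 1/ã² and g̃ᵢ · g̃ⱼ = −1/(d ã²) for i ≠ j (1 ≤ i, j ≤ d), and set g̃₀ = −Σ_{i=1}^d g̃ᵢ. Let F be an invertible d×d real matrix and M a symmetric positive definite d×d real matrix. Then ‖F⁻¹ M⁻¹ F⁻ᵀ‖ ≤ d² ã² · max_{0 ≤ i ≤ d} (F⁻ᵀ g̃ᵢ)ᵀ M⁻¹ (F⁻ᵀ g̃ᵢ). (This is the upper bound of the lemma relating ‖(F_K')⁻¹ M_K⁻¹ (F_K')⁻ᵀ‖ to the minimum altitude a_{K,M} of K in the metric M, namely ‖(F_K')⁻¹ M_K⁻¹ (F_K')⁻ᵀ‖ ≤ d² ã² / a_{K,M}².) -/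
open Matrix BigOperators

/-- The spectral norm (operator 2-norm) of a real square matrix. -/
noncomputable def specNorm {d : ℕ} (A : Matrix (Fin d) (Fin d) ℝ) : ℝ :=
  ‖Matrix.toEuclideanCLM (𝕜 := ℝ) A‖

open Matrix.Norms.L2Operator in
theorem specNorm_conjTranspose_mul_self_le_trace {d : ℕ} (B : Matrix (Fin d) (Fin d) ℝ) :
    specNorm (Bᴴ * B) ≤ (Bᴴ * B).trace := by
  have htr : (Bᴴ * B).trace = ∑ i, ∑ j, B i j ^ 2 := by
    rw [Finset.sum_comm]
    simp [Matrix.trace, Matrix.mul_apply, sq]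
  have h0 : 0 ≤ (Bᴴ * B).trace := by rw [htr]; positivity
  have hB : ‖B‖ ≤ √(Bᴴ * B).trace := by
    rw [← Matrix.l2_opNorm_toEuclideanCLM]
    refine ContinuousLinearMap.opNorm_le_bound _ (Real.sqrt_nonneg _) fun x => ?_
    refine (sq_le_sq₀ (by positivity) (by positivity)).mp ?_
    rw [mul_pow, Real.sq_sqrt h0, htr, EuclideanSpace.norm_sq_eq, EuclideanSpace.norm_sq_eq,
      Finset.sum_mul]
    refine Finset.sum_le_sum fun i _ => ?_
    simpa [Matrix.mulVec, dotProduct] using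
      Finset.sum_mul_sq_le_sq_mul_sq Finset.univ (fun j => B i j) (fun j => x j)
  calc specNorm (Bᴴ * B) = ‖B‖ * ‖B‖ := Matrix.l2_opNorm_conjTranspose_mul_self B
    _ ≤ √(Bᴴ * B).trace * √(Bᴴ * B).trace := by gcongr
    _ = (Bᴴ * B).trace := Real.mul_self_sqrt h0

open MatrixOrder in
theorem Matrix.PosSemidef.specNorm_le_trace {d : ℕ} {A : Matrix (Fin d) (Fin d) ℝ}
    (hA : A.PosSemidef) : specNorm A ≤ A.trace := by
  obtain ⟨B, rfl⟩ := CStarAlgebra.nonneg_iff_eq_star_mul_self.mp hA.nonneg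
  exact specNorm_conjTranspose_mul_self_le_trace B

/-- The gradients of the basis functions of an equilateral simplex form a tight frame. -/
theorem equilateral_gradients_tight_frame {d : ℕ} (hd : 1 ≤ d) {a : ℝ} (ha : 0 < a)
    {g : Fin d → Fin d → ℝ}
    (hdiag : ∀ i, g i ⬝ᵥ g i = 1 / a ^ 2)
    (hoff : ∀ i j, i ≠ j → g i ⬝ᵥ g j = -(1 / (d * a ^ 2)))
    {G : Fin (d + 1) → Fin d → ℝ}
    (hG0 : G 0 = -∑ k, g k)
    (hGsucc : ∀ i : Fin d, G i.succ = g i) :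
    (Matrix.of G)ᵀ * Matrix.of G = (((d : ℝ) + 1) / (d * a ^ 2)) • 1 := by
  have hd' : (0 : ℝ) < d := by exact_mod_cast hd
  set c : ℝ := ((d : ℝ) + 1) / (d * a ^ 2) with hc
  have hc0 : c ≠ 0 := by positivity
  set P : Matrix (Fin d) (Fin d) ℝ := Matrix.of g with hP
  let J : Matrix (Fin d) (Fin d) ℝ := Matrix.of fun _ _ => 1
  have hgram : P * Pᵀ = c • 1 - (1 / (d * a ^ 2)) • J := by
    ext i j
    have h : (P * Pᵀ) i j = g i ⬝ᵥ g j := rfl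
    rw [h]
    by_cases hij : i = j
    · subst hij
      simp only [hdiag, J, Matrix.sub_apply, Matrix.smul_apply, Matrix.one_apply_eq,
        Matrix.of_apply, smul_eq_mul, hc]
      field_simp
      ring
    · simp [hoff i j hij, J, Matrix.one_apply_ne hij]
  have hJJ : J * J = (d : ℝ) • J := by
    ext i j
    simp [J, Matrix.mul_apply]
  have hinv : P * (c⁻¹ • (Pᵀ * (1 + J))) = 1 := by
    rw [Matrix.mul_smul, ← Matrix.mul_assoc, hgram, Matrix.sub_mul, Matrix.mul_add, Matrix.mul_add,
      Matrix.smul_mul, Matrix.smul_mul, Matrix.smul_mul, Matrix.smul_mul, hJJ, mul_one, mul_one,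
      one_mul]
    have : c • J = (1 / (d * a ^ 2)) • J + (1 / (d * a ^ 2)) • (d : ℝ) • J := by
      rw [smul_smul, ← add_smul, hc]
      congr 1
      field_simp
      ring
    rw [this, add_sub_cancel_right, smul_smul, inv_mul_cancel₀ hc0, one_smul]
  have hinv' : Pᵀ * (1 + J) * P = c • 1 := by
    have h := mul_eq_one_comm.mp hinv
    rw [Matrix.smul_mul] at h
    exact (inv_smul_eq_iff₀ hc0).mp h
  rw [← hinv', Matrix.mul_add, Matrix.add_mul, mul_one]
  ext i j
  simp [Matrix.mul_apply, Fin.sum_univ_succ, hG0, hGsucc, hP, J, Finset.mul_sum, add_comm]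

/-- upper bound on ‖F⁻¹ M⁻¹ F⁻ᵀ‖ via the gradients of the linear basis
functions of an equilateral simplex with altitude `a`:
‖F⁻¹ M⁻¹ F⁻ᵀ‖ ≤ d² a² · max_i (F⁻ᵀ g̃ᵢ)ᵀ M⁻¹ (F⁻ᵀ g̃ᵢ). -/
theorem spec_norm_inv_metric_upper_bound
    {d : ℕ} (hd : 1 ≤ d) (a : ℝ) (ha : 0 < a)
    (g : Fin d → Fin d → ℝ)
    (hdiag : ∀ i, g i ⬝ᵥ g i = 1 / a ^ 2)
    (hoff : ∀ i j, i ≠ j → g i ⬝ᵥ g j = -(1 / (d * a ^ 2)))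
    (F M : Matrix (Fin d) (Fin d) ℝ)
    (hF : IsUnit F.det) (hM : M.PosDef)
    (G : Fin (d + 1) → Fin d → ℝ)
    (hG0 : G 0 = -∑ k, g k)
    (hGsucc : ∀ i : Fin d, G i.succ = g i) :
    specNorm (F⁻¹ * M⁻¹ * F⁻¹ᵀ)
      ≤ (d : ℝ) ^ 2 * a ^ 2 * (⨆ i : Fin (d + 1),
          (F⁻¹ᵀ *ᵥ G i) ⬝ᵥ (M⁻¹ *ᵥ (F⁻¹ᵀ *ᵥ G i))) := by
  have hd' : (1 : ℝ) ≤ d := by exact_mod_cast hd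
  set A : Matrix (Fin d) (Fin d) ℝ := F⁻¹ * M⁻¹ * F⁻¹ᵀ with hA
  have hpsd : A.PosSemidef := by
    simpa using hM.inv.posSemidef.mul_mul_conjTranspose_same F⁻¹
  set q : Fin (d + 1) → ℝ := fun i => (F⁻¹ᵀ *ᵥ G i) ⬝ᵥ (M⁻¹ *ᵥ (F⁻¹ᵀ *ᵥ G i)) with hq
  have hqA : ∀ i, q i = G i ⬝ᵥ (A *ᵥ G i) := fun i => by
    simp only [hq, hA, ← Matrix.mulVec_mulVec, Matrix.dotProduct_mulVec (G i) F⁻¹,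
      Matrix.mulVec_transpose]
  have hsum : ∑ i, q i = (((d : ℝ) + 1) / (d * a ^ 2)) * A.trace := by
    have h : ∑ i, q i = (Matrix.of G * (A * (Matrix.of G)ᵀ)).trace :=
      Finset.sum_congr rfl fun i _ => hqA i
    rw [h, Matrix.trace_mul_comm, Matrix.mul_assoc,
      equilateral_gradients_tight_frame hd ha hdiag hoff hG0 hGsucc]
    simp
  have hle : ∑ i, q i ≤ ((d : ℝ) + 1) * ⨆ i, q i := by
    have h := Finset.sum_le_card_nsmul Finset.univ q (⨆ i, q i)
      fun i _ => le_ciSup (Set.finite_range q).bddAbove i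
    simpa using h
  have htr : A.trace ≤ d * a ^ 2 * ⨆ i, q i := by
    rw [hsum, div_mul_eq_mul_div, div_le_iff₀ (by positivity), mul_assoc] at hle
    have h := le_of_mul_le_mul_left hle (by positivity)
    linarith
  have hs : 0 ≤ ⨆ i, q i :=
    Real.iSup_nonneg fun i => by
      rw [hqA]
      simpa using hpsd.dotProduct_mulVec_nonneg (G i)
  calc specNorm A ≤ A.trace := hpsd.specNorm_le_trace
    _ ≤ d * a ^ 2 * ⨆ i, q i := htr
    _ ≤ (d : ℝ) ^ 2 * a ^ 2 * ⨆ i, q i := by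
      gcongr
      exact le_self_pow₀ hd' two_ne_zero
end

section
/- Let d ≥ 1, let F be a d×d real matrix, let M be a symmetric positive semidefinite d×d real matrix, let c ∈ ℝ^d and ρ̃ > 0, and let S ⊆ ℝ^d be a bounded set containing the closed Euclidean ball of center c and radius ρ̃/2. Then ‖Fᵀ M F‖ · ρ̃² ≤ sup { (F(u − v))ᵀ M (F(u − v)) : u, v ∈ S }. (This is the right inequality of the lemma stating ‖(F_K')ᵀ M_K F_K'‖ ≤ h_{K,M}²/ρ̃², where h_{K,M} is the diameter of the image of S under F in the metric M and ρ̃ is the in-diameter of S.) -/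
open Matrix BigOperators

/-- A quadratic form is bounded above on the differences of points of a bounded set. -/
theorem bddAbove_quadratic_sub_of_isBounded {d : ℕ} (F M : Matrix (Fin d) (Fin d) ℝ)
    {S : Set (Fin d → ℝ)} (hS : Bornology.IsBounded S) :
    BddAbove {x : ℝ | ∃ u ∈ S, ∃ v ∈ S,
      x = (F *ᵥ (u - v)) ⬝ᵥ (M *ᵥ (F *ᵥ (u - v)))} := by
  have hcont : Continuous fun p : (Fin d → ℝ) × (Fin d → ℝ) =>
      (F *ᵥ (p.1 - p.2)) ⬝ᵥ (M *ᵥ (F *ᵥ (p.1 - p.2))) := by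
    fun_prop
  refine ((hS.isCompact_closure.prod hS.isCompact_closure).bddAbove_image
    hcont.continuousOn).mono ?_
  rintro x ⟨u, hu, v, hv, rfl⟩
  exact ⟨(u, v), ⟨subset_closure hu, subset_closure hv⟩, rfl⟩

/-- The inner product against `Fᵀ M F` is the form `M` pulled back along `F`. -/
theorem inner_toEuclideanCLM_transpose_mul_mul {d : ℕ} (F M : Matrix (Fin d) (Fin d) ℝ)
    (x : EuclideanSpace ℝ (Fin d)) :
    inner ℝ (Matrix.toEuclideanCLM (𝕜 := ℝ) (Fᵀ * M * F) x) x =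
      (F *ᵥ x.ofLp) ⬝ᵥ (M *ᵥ (F *ᵥ x.ofLp)) := by
  rw [real_inner_comm, Matrix.inner_toEuclideanCLM, ← Matrix.mulVec_mulVec,
    ← Matrix.mulVec_mulVec, Matrix.dotProduct_mulVec, Matrix.vecMul_transpose]

/-- if the bounded set `S` contains a closed Euclidean ball of radius `ρ/2`,
then `‖Fᵀ M F‖ · ρ² ≤ sup { (F(u−v))ᵀ M (F(u−v)) : u, v ∈ S }`. -/
theorem metric_in_diameter_lower_bound
    {d : ℕ} (hd : 1 ≤ d)
    (F M : Matrix (Fin d) (Fin d) ℝ)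
    (hM : M.PosSemidef)
    (c : Fin d → ℝ) (ρ : ℝ) (hρ : 0 < ρ)
    (S : Set (Fin d → ℝ))
    (hSbdd : Bornology.IsBounded S)
    (hball : ∀ u : Fin d → ℝ, Real.sqrt (∑ j, (u j - c j) ^ 2) ≤ ρ / 2 → u ∈ S) :
    specNorm (Fᵀ * M * F) * ρ ^ 2 ≤
      sSup {x : ℝ | ∃ u ∈ S, ∃ v ∈ S,
        x = (F *ᵥ (u - v)) ⬝ᵥ (M *ᵥ (F *ᵥ (u - v)))} := by
  have hbdd := bddAbove_quadratic_sub_of_isBounded F M hSbdd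
  have hball' (y : EuclideanSpace ℝ (Fin d)) (hy : ‖y‖ ≤ ρ / 2) : c + y.ofLp ∈ S := by
    apply hball
    rw [EuclideanSpace.norm_eq] at hy
    simpa using hy
  have hherm : (Fᵀ * M * F).IsHermitian := by
    simpa [Matrix.conjTranspose_eq_transpose_of_trivial] using
      Matrix.isHermitian_conjTranspose_mul_mul F hM.isHermitian
  have hsymm : (Matrix.toEuclideanCLM (𝕜 := ℝ) (Fᵀ * M * F)).IsSymmetric := by
    rw [Matrix.coe_toEuclideanCLM_eq_toEuclideanLin]
    exact Matrix.isSymmetric_toEuclideanLin_iff.mpr hherm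
  rw [specNorm, ContinuousLinearMap.norm_eq_iSup_rayleighQuotient _ hsymm,
    ← le_div_iff₀ (by positivity)]
  refine ciSup_le fun x => ?_
  have hform : 0 ≤ (F *ᵥ x.ofLp) ⬝ᵥ (M *ᵥ (F *ᵥ x.ofLp)) := by
    simpa using hM.dotProduct_mulVec_nonneg (F *ᵥ x.ofLp)
  rw [ContinuousLinearMap.rayleighQuotient, ContinuousLinearMap.reApplyInnerSelf_apply,
    RCLike.re_to_real, inner_toEuclideanCLM_transpose_mul_mul,
    abs_of_nonneg (by positivity), le_div_iff₀ (by positivity)]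
  set y : EuclideanSpace ℝ (Fin d) := (ρ / 2 / ‖x‖) • x with hy
  have hynorm : ‖y‖ ≤ ρ / 2 := by
    rw [hy, norm_smul, Real.norm_of_nonneg (by positivity), div_mul_eq_mul_div, mul_div_assoc]
    exact mul_le_of_le_one_right (by positivity) (div_self_le_one _)
  refine le_csSup hbdd
    ⟨c + y.ofLp, hball' y hynorm, c + (-y).ofLp, hball' (-y) (by rwa [norm_neg]), ?_⟩
  have hdiff : c + y.ofLp - (c + (-y).ofLp) = (ρ / ‖x‖) • x.ofLp := by
    ext i
    simp [hy]
    ring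
  rw [hdiff]
  simp only [Matrix.mulVec_smul, smul_dotProduct, dotProduct_smul, smul_eq_mul]
  ring
end

section
/- Let N ≥ 1, let f : ℝᴺ → ℝ be continuously differentiable, let τ > 0, and for each i ∈ {1, …, N} let pᵢ : ℝᴺ → ℝ be a function with pᵢ(y) > 0 for all y. Suppose x : [0, ∞) → ℝᴺ is differentiable and solves the modified gradient system xᵢ'(t) = −(pᵢ(x(t))/τ) · ∂f/∂xᵢ(x(t)) for all t ≥ 0 and all i. Then for every t ≥ 0 the function f∘x is differentiable at t with (f∘x)'(t) = −(1/τ) Σ_{i=1}^N pᵢ(x(t)) (∂f/∂xᵢ(x(t)))² ≤ 0, and consequently t ↦ f(x(t)) is nonincreasing on [0, ∞). -/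
open BigOperators Filter

/-- along a solution of the modified gradient system
`xᵢ' = −(pᵢ(x)/τ) ∂f/∂xᵢ(x)`, the energy `f(x(t))` has derivative
`−(1/τ) Σᵢ pᵢ(x(t)) (∂f/∂xᵢ(x(t)))² ≤ 0` and is nonincreasing on `[0, ∞)`. -/
theorem modified_gradient_system_energy_decreasing
    {N : ℕ} (hN : 1 ≤ N)
    (f : (Fin N → ℝ) → ℝ) (hf : ContDiff ℝ 1 f)
    (τ : ℝ) (hτ : 0 < τ)
    (p : Fin N → (Fin N → ℝ) → ℝ)
    (hp : ∀ i y, 0 < p i y)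
    (x : ℝ → Fin N → ℝ)
    (hode : ∀ t ≥ (0 : ℝ), HasDerivAt x
      (fun i => -(p i (x t) / τ) * fderiv ℝ f (x t) (Pi.single i 1)) t) :
    (∀ t ≥ (0 : ℝ),
      HasDerivAt (fun s => f (x s))
        (-(1 / τ) * ∑ i, p i (x t) * (fderiv ℝ f (x t) (Pi.single i 1)) ^ 2) t ∧
      -(1 / τ) * ∑ i, p i (x t) * (fderiv ℝ f (x t) (Pi.single i 1)) ^ 2 ≤ 0) ∧
    AntitoneOn (fun t => f (x t)) (Set.Ici (0 : ℝ)) := by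
  have hderiv : ∀ t ≥ (0 : ℝ), HasDerivAt (fun s => f (x s))
      (-(1 / τ) * ∑ i, p i (x t) * (fderiv ℝ f (x t) (Pi.single i 1)) ^ 2) t := by
    intro t ht
    have hfx : HasFDerivAt f (fderiv ℝ f (x t)) (x t) :=
      (hf.differentiable one_ne_zero (x t)).hasFDerivAt
    refine (hfx.comp_hasDerivAt t (hode t ht)).congr_deriv ?_
    rw [← ContinuousLinearMap.coe_coe, LinearMap.pi_apply_eq_sum_univ, Finset.mul_sum]
    refine Finset.sum_congr rfl fun i _ => ?_
    have hsingle : (fun j => if i = j then (1 : ℝ) else 0) = Pi.single i 1 := by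
      ext j
      simp [Pi.single_apply, eq_comm]
    simp only [hsingle, ContinuousLinearMap.coe_coe, smul_eq_mul]
    ring
  have hnonpos : ∀ t, -(1 / τ) * ∑ i, p i (x t) * (fderiv ℝ f (x t) (Pi.single i 1)) ^ 2 ≤ 0 :=
    fun t => mul_nonpos_of_nonpos_of_nonneg (neg_nonpos.2 (one_div_pos.2 hτ).le)
      (Finset.sum_nonneg fun i _ => mul_nonneg (hp i _).le (sq_nonneg _))
  refine ⟨fun t ht => ⟨hderiv t ht, hnonpos t⟩, ?_⟩
  refine antitoneOn_of_hasDerivWithinAt_nonpos (convex_Ici 0)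
    (fun t ht => (hderiv t ht).continuousAt.continuousWithinAt)
    (fun t ht => (hderiv t (interior_subset ht)).hasDerivWithinAt) fun t _ => hnonpos t
end

section
/- Let N ≥ 1, let f : ℝᴺ → ℝ be continuously differentiable, let τ > 0, and for each i let pᵢ : ℝᴺ → ℝ satisfy pᵢ(y) > 0 for all y. Suppose x : [0, ∞) → ℝᴺ is differentiable, solves xᵢ'(t) = −(pᵢ(x(t))/τ) · ∂f/∂xᵢ(x(t)) for all t ≥ 0 and all i, and there is a compact set K ⊆ ℝᴺ with x(t) ∈ K for all t ≥ 0. Then the limit lim_{t→∞} f(x(t)) exists (as a real number). -/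
open BigOperators Filter

/-- A real function that is antitone and bounded below on `[a, ∞)` converges at infinity. -/
theorem AntitoneOn.exists_tendsto_atTop_of_bddBelow {g : ℝ → ℝ} {a : ℝ}
    (hg : AntitoneOn g (Set.Ici a)) (hb : BddBelow (g '' Set.Ici a)) :
    ∃ L : ℝ, Tendsto g atTop (nhds L) := by
  have hanti : Antitone fun t => g (max t a) := fun s t hst =>
    hg (le_max_right s a) (le_max_right t a) (max_le_max_right a hst)
  have hbdd : BddBelow (Set.range fun t => g (max t a)) :=
    hb.mono (Set.range_subset_iff.2 fun t => Set.mem_image_of_mem g (le_max_right t a))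
  refine ⟨_, (tendsto_atTop_ciInf hanti hbdd).congr' ?_⟩
  filter_upwards [eventually_ge_atTop a] with t ht
  rw [max_eq_left ht]

/-- A linear form on `ℝᴺ` is nonpositive on every vector whose coordinates are nonpositive
multiples of its own coefficients. -/
theorem ContinuousLinearMap.apply_neg_mul_apply_single_nonpos {ι : Type*} [Fintype ι]
    [DecidableEq ι] (l : (ι → ℝ) →L[ℝ] ℝ) {c : ι → ℝ} (hc : ∀ i, 0 ≤ c i) :
    l (fun i => -c i * l (Pi.single i 1)) ≤ 0 := by
  rw [← ContinuousLinearMap.coe_coe, LinearMap.pi_apply_eq_sum_univ]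
  refine Finset.sum_nonpos fun i _ => ?_
  have hsingle : (fun j => if i = j then (1 : ℝ) else 0) = Pi.single i 1 := by
    ext j
    simp [Pi.single_apply, eq_comm]
  rw [hsingle, smul_eq_mul, ContinuousLinearMap.coe_coe]
  nlinarith [mul_nonneg (hc i) (mul_self_nonneg (l (Pi.single i 1)))]

/-- along a solution of the modified gradient system
`xᵢ' = −(pᵢ(x)/τ) ∂f/∂xᵢ(x)` that stays in a compact set, the energy `f(x(t))`
converges to a real limit as `t → ∞`. -/
theorem modified_gradient_system_energy_limit
    {N : ℕ} (hN : 1 ≤ N)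
    (f : (Fin N → ℝ) → ℝ) (hf : ContDiff ℝ 1 f)
    (τ : ℝ) (hτ : 0 < τ)
    (p : Fin N → (Fin N → ℝ) → ℝ)
    (hp : ∀ i y, 0 < p i y)
    (x : ℝ → Fin N → ℝ)
    (hode : ∀ t ≥ (0 : ℝ), HasDerivAt x
      (fun i => -(p i (x t) / τ) * fderiv ℝ f (x t) (Pi.single i 1)) t)
    (K : Set (Fin N → ℝ)) (hK : IsCompact K)
    (hxK : ∀ t ≥ (0 : ℝ), x t ∈ K) :
    ∃ L : ℝ, Tendsto (fun t => f (x t)) atTop (nhds L) := by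
  have hderiv : ∀ t ≥ (0 : ℝ), HasDerivAt (fun s => f (x s))
      (fderiv ℝ f (x t) fun i => -(p i (x t) / τ) * fderiv ℝ f (x t) (Pi.single i 1)) t :=
    fun t ht =>
      (hf.differentiable one_ne_zero (x t)).hasFDerivAt.comp_hasDerivAt t (hode t ht)
  have hanti : AntitoneOn (fun t => f (x t)) (Set.Ici 0) := by
    refine antitoneOn_of_hasDerivWithinAt_nonpos (convex_Ici 0)
      (fun t ht => (hderiv t ht).continuousAt.continuousWithinAt)
      (fun t ht => (hderiv t (interior_subset ht)).hasDerivWithinAt) fun t _ => ?_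
    exact (fderiv ℝ f (x t)).apply_neg_mul_apply_single_nonpos
      fun i => (div_pos (hp i (x t)) hτ).le
  refine hanti.exists_tendsto_atTop_of_bddBelow
    ((hK.bddBelow_image hf.continuous.continuousOn).mono ?_)
  rintro _ ⟨t, ht, rfl⟩
  exact Set.mem_image_of_mem f (hxK t ht)
end

section
/- Let N ≥ 1, let f : ℝᴺ → ℝ be twice continuously differentiable, let τ > 0, and for each i let pᵢ : ℝᴺ → ℝ be continuous with pᵢ(y) > 0 for all y. Suppose x : [0, ∞) → ℝᴺ is differentiable, solves xᵢ'(t) = −(pᵢ(x(t))/τ) · ∂f/∂xᵢ(x(t)) for all t ≥ 0 and all i, and there is a compact set K ⊆ ℝᴺ with x(t) ∈ K for all t ≥ 0. If (t_k) is a sequence with t_k → ∞ and x(t_k) → x* for some x* ∈ ℝᴺ, then x* is a critical point of f, i.e. ∂f/∂xᵢ(x*) = 0 for every i ∈ {1, …, N}. -/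
open BigOperators Filter

/-- If `f` is nonincreasing along the continuous vector field `V`, then at every limit of a sequence
`x (t k)`, `t k → ∞`, along a solution of `x' = V x` staying in a compact set, the derivative of
`f` in the direction `V` vanishes. -/
theorem fderiv_apply_eq_zero_of_tendsto_solution {E : Type*} [NormedAddCommGroup E]
    [NormedSpace ℝ E] {f : E → ℝ} (hf : ContDiff ℝ 1 f) {V : E → E} (hV : Continuous V)
    (hle : ∀ y, fderiv ℝ f y (V y) ≤ 0) {x : ℝ → E}
    (hx : ∀ t ≥ (0 : ℝ), HasDerivAt x (V (x t)) t) {K : Set E} (hK : IsCompact K)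
    (hxK : ∀ t ≥ (0 : ℝ), x t ∈ K) {t : ℕ → ℝ} (ht : Tendsto t atTop atTop) {y : E}
    (hy : Tendsto (fun k => x (t k)) atTop (nhds y)) :
    fderiv ℝ f y (V y) = 0 := by
  by_contra hne
  have hneg : fderiv ℝ f y (V y) < 0 := lt_of_le_of_ne (hle y) hne
  have hcont : Continuous fun z => fderiv ℝ f z (V z) :=
    (hf.continuous_fderiv one_ne_zero).clm_apply hV
  have hφ : ∀ s ≥ (0 : ℝ), HasDerivAt (fun u => f (x u)) (fderiv ℝ f (x s) (V (x s))) s :=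
    fun s hs => ((hf.differentiable one_ne_zero (x s)).hasFDerivAt).comp_hasDerivAt s (hx s hs)
  have hdrop : ∀ C a b : ℝ, 0 ≤ a → a ≤ b →
      (∀ s ∈ Set.Icc a b, fderiv ℝ f (x s) (V (x s)) ≤ C) →
      f (x b) - f (x a) ≤ C * (b - a) := by
    intro C a b ha hab hC
    refine (convex_Icc a b).image_sub_le_mul_sub_of_deriv_le (f := fun u => f (x u))
      (fun s hs => (hφ s (ha.trans hs.1)).continuousAt.continuousWithinAt)
      (fun s hs => ?_) (fun s hs => ?_) a ⟨le_rfl, hab⟩ b ⟨hab, le_rfl⟩ hab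
    · exact (hφ s (ha.trans (interior_subset hs).1)).differentiableAt.differentiableWithinAt
    · rw [(hφ s (ha.trans (interior_subset hs).1)).deriv]
      exact hC s (interior_subset hs)
  have hlim : Tendsto (fun k => f (x (t k))) atTop (nhds (f y)) :=
    (hf.continuous.tendsto y).comp hy
  have hlower : ∀ s ≥ (0 : ℝ), f y ≤ f (x s) := by
    intro s hs
    refine le_of_tendsto hlim ?_
    filter_upwards [ht.eventually_ge_atTop s] with k hk
    have := hdrop 0 s (t k) hs hk fun u _ => hle (x u)
    linarith
  obtain ⟨L, hL⟩ := hK.exists_bound_of_continuousOn hV.continuousOn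
  have hL0 : 0 ≤ L := (norm_nonneg _).trans (hL (x 0) (hxK 0 le_rfl))
  have hlip : ∀ a b : ℝ, 0 ≤ a → a ≤ b → ‖x b - x a‖ ≤ L * (b - a) := by
    intro a b ha hab
    have := (convex_Ici (0 : ℝ)).norm_image_sub_le_of_norm_hasDerivWithin_le
      (fun s hs => (hx s hs).hasDerivWithinAt) (fun s hs => hL _ (hxK s hs))
      (Set.mem_Ici.2 ha) (Set.mem_Ici.2 (ha.trans hab))
    rwa [Real.norm_of_nonneg (sub_nonneg.2 hab)] at this
  obtain ⟨C, hC, hC0⟩ := exists_between hneg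
  obtain ⟨r, hr, hball⟩ := Metric.eventually_nhds_iff.1 (hcont.continuousAt.eventually_lt_const hC)
  set δ := r / (2 * (L + 1)) with hδ
  have hδ0 : 0 < δ := by positivity
  have hLδ : L * δ ≤ r / 2 := by
    have : (L + 1) * δ = r / 2 := by rw [hδ]; field_simp
    nlinarith
  have hnear := Metric.tendsto_nhds.1 hy (r / 2) (half_pos hr)
  have hclose := hlim.eventually_lt_const (show f y < f y - C * δ by nlinarith)
  obtain ⟨k, hk0, hk1, hk2⟩ := ((ht.eventually_ge_atTop 0).and (hnear.and hclose)).exists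
  have hd := hdrop C (t k) (t k + δ) hk0 (by linarith) fun s hs => by
    refine (hball ?_).le
    have h1 := hlip (t k) s hk0 hs.1
    have h2 : L * (s - t k) ≤ L * δ := by
      gcongr
      linarith [hs.2]
    rw [← dist_eq_norm] at h1
    linarith [dist_triangle (x s) (x (t k)) y]
  have hl := hlower (t k + δ) (by linarith)
  rw [add_sub_cancel_left] at hd
  linarith

/-- The derivative in the direction of a vector of coordinatewise multiples of the negative gradient
is minus a weighted sum of squared partial derivatives. -/
theorem map_neg_mul_apply_single {ι : Type*} [Fintype ι] [DecidableEq ι]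
    (l : (ι → ℝ) →L[ℝ] ℝ) (w : ι → ℝ) :
    l (fun i => -w i * l (Pi.single i 1)) = -∑ i, w i * l (Pi.single i 1) ^ 2 := by
  conv_lhs => rw [← Finset.univ_sum_single (fun i => -w i * l (Pi.single i 1))]
  rw [map_sum, ← Finset.sum_neg_distrib]
  refine Finset.sum_congr rfl fun i _ => ?_
  rw [← mul_one (-w i * _), ← smul_eq_mul, Pi.single_smul, map_smul, smul_eq_mul]
  ring

/-- along a solution of the modified gradient system
`xᵢ' = −(pᵢ(x)/τ) ∂f/∂xᵢ(x)` (with `f` twice continuously differentiable and `pᵢ`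
continuous and positive) that stays in a compact set, every limit of a sequence
`x(t_k)` with `t_k → ∞` is a critical point of `f`. -/
theorem modified_gradient_system_limit_mesh_critical
    {N : ℕ} (hN : 1 ≤ N)
    (f : (Fin N → ℝ) → ℝ) (hf : ContDiff ℝ 2 f)
    (τ : ℝ) (hτ : 0 < τ)
    (p : Fin N → (Fin N → ℝ) → ℝ)
    (hpc : ∀ i, Continuous (p i))
    (hp : ∀ i y, 0 < p i y)
    (x : ℝ → Fin N → ℝ)
    (hode : ∀ t ≥ (0 : ℝ), HasDerivAt x
      (fun i => -(p i (x t) / τ) * fderiv ℝ f (x t) (Pi.single i 1)) t)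
    (K : Set (Fin N → ℝ)) (hK : IsCompact K)
    (hxK : ∀ t ≥ (0 : ℝ), x t ∈ K)
    (tseq : ℕ → ℝ) (htseq : Tendsto tseq atTop atTop)
    (xstar : Fin N → ℝ)
    (hconv : Tendsto (fun k => x (tseq k)) atTop (nhds xstar)) :
    ∀ i, fderiv ℝ f xstar (Pi.single i 1) = 0 := by
  have hw : ∀ i y, 0 < p i y / τ := fun i y => div_pos (hp i y) hτ
  have hV : Continuous fun y => fun i => -(p i y / τ) * fderiv ℝ f y (Pi.single i 1) :=
    continuous_pi fun i => ((hpc i).div_const τ).neg.mul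
      ((hf.continuous_fderiv two_ne_zero).clm_apply continuous_const)
  have hnonneg : ∀ y i, 0 ≤ p i y / τ * fderiv ℝ f y (Pi.single i 1) ^ 2 :=
    fun y i => mul_nonneg (hw i y).le (sq_nonneg _)
  have hzero := fderiv_apply_eq_zero_of_tendsto_solution (hf.of_le one_le_two) hV
    (fun y => by
      rw [map_neg_mul_apply_single (fderiv ℝ f y) fun i => p i y / τ]
      exact neg_nonpos.2 (Finset.sum_nonneg fun i _ => hnonneg y i))
    hode hK hxK htseq hconv
  rw [map_neg_mul_apply_single (fderiv ℝ f xstar) fun i => p i xstar / τ, neg_eq_zero,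
    Finset.sum_eq_zero_iff_of_nonneg fun i _ => hnonneg xstar i] at hzero
  intro i
  simpa [(hw i xstar).ne'] using hzero i (Finset.mem_univ i)
end

section
/- Let N ≥ 1, let f : ℝᴺ → ℝ be differentiable, and let Φ : ℝᴺ → ℝᴺ be continuous. Assume the strong monotonically-decreasing-energy property: f(Φ(y)) ≤ f(y) for every y ∈ ℝᴺ, and f(Φ(y)) < f(y) whenever ∇f(y) ≠ 0. Let (xⁿ)_{n≥0} be the sequence defined by xⁿ⁺¹ = Φ(xⁿ), and assume it is bounded. Then lim_{n→∞} f(xⁿ) exists, and every limit point x* of (xⁿ) (i.e., every limit of a convergent subsequence) is a critical point of f: ∇f(x*) = 0. -/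
open Filter

/-- for an iteration `xⁿ⁺¹ = Φ(xⁿ)` of a continuous map `Φ` satisfying the
strong monotonically-decreasing-energy property for a differentiable `f`
(`f(Φ(y)) ≤ f(y)` always, strictly whenever `∇f(y) ≠ 0`), if the sequence is bounded then
`f(xⁿ)` converges and every limit point of the sequence is a critical point of `f`. -/
theorem discrete_mmpde_limit_points_critical
    {N : ℕ} (hN : 1 ≤ N)
    (f : (Fin N → ℝ) → ℝ) (hf : Differentiable ℝ f)
    (Φ : (Fin N → ℝ) → (Fin N → ℝ)) (hΦ : Continuous Φ)
    (hdec : ∀ y, f (Φ y) ≤ f y)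
    (hsdec : ∀ y, fderiv ℝ f y ≠ 0 → f (Φ y) < f y)
    (x : ℕ → Fin N → ℝ)
    (hiter : ∀ n, x (n + 1) = Φ (x n))
    (hbdd : Bornology.IsBounded (Set.range x)) :
    (∃ L : ℝ, Tendsto (fun n => f (x n)) atTop (nhds L)) ∧
    ∀ xstar : Fin N → ℝ, ∀ φ : ℕ → ℕ, StrictMono φ →
      Tendsto (fun k => x (φ k)) atTop (nhds xstar) → fderiv ℝ f xstar = 0 := by
  have hanti : Antitone (fun n => f (x n)) :=
    antitone_nat_of_succ_le fun n => by simpa only [hiter n] using hdec (x n)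
  have hcompact : IsCompact (closure (Set.range x)) := hbdd.isCompact_closure
  have hbelow : BddBelow (Set.range fun n => f (x n)) := by
    refine (hcompact.image hf.continuous).bddBelow.mono ?_
    rintro _ ⟨n, rfl⟩
    exact Set.mem_image_of_mem f (subset_closure (Set.mem_range_self n))
  have hlim := tendsto_atTop_ciInf hanti hbelow
  refine ⟨⟨_, hlim⟩, fun xstar φ hφ hx => ?_⟩
  by_contra hcrit
  have h₁ : f xstar = ⨅ n, f (x n) :=
    tendsto_nhds_unique ((hf.continuous.tendsto xstar).comp hx) (hlim.comp hφ.tendsto_atTop)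
  have h₂ : f (Φ xstar) = ⨅ n, f (x n) := by
    refine tendsto_nhds_unique (((hf.continuous.comp hΦ).tendsto xstar).comp hx) ?_
    refine (hlim.comp ((tendsto_add_atTop_nat 1).comp hφ.tendsto_atTop)).congr fun k => ?_
    simp only [Function.comp_apply, hiter]
  exact (hsdec xstar hcrit).ne (h₂.trans h₁.symm)
end

section
/- Let d ≥ 1, let A be a symmetric positive semidefinite d×d real matrix, and let s ≥ 1 be a real number. For E = (ξ₀, ξ₁, …, ξ_d) ∈ (ℝ^d)^{d+1}, let Ê(E) denote the d×d matrix whose columns are ξ₁ − ξ₀, …, ξ_d − ξ₀. Then the function E ↦ (tr(Ê(E) A Ê(E)ᵀ))^s is well defined (the trace is nonnegative) and convex on (ℝ^d)^{d+1}. -/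
open Matrix BigOperators Real

/-- The edge matrix of a tuple of `d+1` vertices: columns `ξ₁ − ξ₀, …, ξ_d − ξ₀`. -/
def edgeMat {d : ℕ} (E : Fin (d + 1) → Fin d → ℝ) : Matrix (Fin d) (Fin d) ℝ :=
  Matrix.of fun i j => E j.succ i - E 0 i

theorem edgeMat_combo {d : ℕ} (X Y : Fin (d + 1) → Fin d → ℝ) (a b : ℝ) :
    edgeMat (a • X + b • Y) = a • edgeMat X + b • edgeMat Y := by
  ext i j
  simp only [edgeMat, Matrix.of_apply, Matrix.add_apply, Matrix.smul_apply, Pi.add_apply,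
    Pi.smul_apply, smul_eq_mul]
  ring

theorem Matrix.PosSemidef.trace_mul_mul_transpose_nonneg {m n : Type*} [Fintype m] [Fintype n]
    {A : Matrix n n ℝ} (hA : A.PosSemidef) (M : Matrix m n ℝ) :
    0 ≤ Matrix.trace (M * A * Mᵀ) := by
  have h := (hA.mul_mul_conjTranspose_same M).trace_nonneg
  rwa [Matrix.conjTranspose_eq_transpose_of_trivial] at h

theorem Matrix.PosSemidef.convexOn_trace_mul_mul_transpose {m n : Type*} [Fintype m] [Fintype n]
    {A : Matrix n n ℝ} (hA : A.PosSemidef) :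
    ConvexOn ℝ Set.univ (fun M : Matrix m n ℝ => Matrix.trace (M * A * Mᵀ)) := by
  refine ⟨convex_univ, fun M _ N _ a b ha hb hab => ?_⟩
  have h := mul_nonneg (mul_nonneg ha hb) (hA.trace_mul_mul_transpose_nonneg (M - N))
  obtain rfl : b = 1 - a := by linarith
  simp only [Matrix.transpose_sub, Matrix.transpose_add, Matrix.transpose_smul, Matrix.add_mul,
    Matrix.sub_mul, Matrix.mul_add, Matrix.mul_sub, Matrix.smul_mul, Matrix.mul_smul,
    Matrix.trace_add, Matrix.trace_sub, Matrix.trace_smul, smul_eq_mul] at h ⊢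
  linarith

/-- for symmetric positive semidefinite `A` and real `s ≥ 1`, the function
`E ↦ (tr(Ê(E) A Ê(E)ᵀ))^s` is well defined (the trace is nonnegative) and convex. -/
theorem betaFn_rpow_convex
    {d : ℕ} (hd : 1 ≤ d)
    (A : Matrix (Fin d) (Fin d) ℝ) (hA : A.PosSemidef)
    (s : ℝ) (hs : 1 ≤ s) :
    (∀ E : Fin (d + 1) → Fin d → ℝ, 0 ≤ Matrix.trace (edgeMat E * A * (edgeMat E)ᵀ)) ∧
    ConvexOn ℝ Set.univ
      (fun E : Fin (d + 1) → Fin d → ℝ =>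
        (Matrix.trace (edgeMat E * A * (edgeMat E)ᵀ)) ^ s) := by
  have hnn (E : Fin (d + 1) → Fin d → ℝ) : 0 ≤ Matrix.trace (edgeMat E * A * (edgeMat E)ᵀ) :=
    hA.trace_mul_mul_transpose_nonneg (edgeMat E)
  refine ⟨hnn, convex_univ, fun X _ Y _ a b ha hb hab => ?_⟩
  have hconv := hA.convexOn_trace_mul_mul_transpose.2 (Set.mem_univ (edgeMat X))
    (Set.mem_univ (edgeMat Y)) ha hb hab
  rw [← edgeMat_combo] at hconv
  exact (Real.rpow_le_rpow (hnn _) hconv (by linarith)).trans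
    ((convexOn_rpow hs).2 (hnn X) (hnn Y) ha hb hab)
end

section
/- Let d ≥ 1, let p ≥ 1 be a real number, let θ ∈ (0, 1/2], let m̲ > 0, let M be a symmetric positive definite d×d real matrix with M ≥ m̲ I (in the sense of positive semidefiniteness of M − m̲ I), and let J be a d×d real matrix with det J ≥ 0. Define G = θ √(det M) (tr(J M⁻¹ Jᵀ))^{dp/2} + (1 − 2θ) d^{dp/2} (det M)^{(1−p)/2} (det J)^p. Then G ≥ θ m̲^{d/2} (tr(J M⁻¹ Jᵀ))^{dp/2}. In particular, for p > 1 the integrand of Huang's meshing functional satisfies the coercivity condition G ≥ α (tr(J M⁻¹ Jᵀ))^q with α = θ m̲^{d/2} > 0, β = 0, and q = dp/2 > d/2. -/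
open Matrix BigOperators Real

/-- If `M - m • 1` is positive semidefinite, every eigenvalue of `M` is at least `m`. -/
theorem Matrix.IsHermitian.le_eigenvalues_of_posSemidef_sub_smul_one
    {n : Type*} [Fintype n] [DecidableEq n] {M : Matrix n n ℝ} (hM : M.IsHermitian) {m : ℝ}
    (h : (M - m • (1 : Matrix n n ℝ)).PosSemidef) (i : n) : m ≤ hM.eigenvalues i := by
  have hspec : hM.eigenvalues i ∈ spectrum ℝ M := hM.eigenvalues_mem_spectrum_real i
  have hshift : hM.eigenvalues i - m ∈ spectrum ℝ (M - m • (1 : Matrix n n ℝ)) := by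
    rw [← Algebra.algebraMap_eq_smul_one, ← spectrum.sub_singleton_eq]
    exact Set.sub_mem_sub hspec rfl
  rw [h.isHermitian.spectrum_real_eq_range_eigenvalues] at hshift
  obtain ⟨j, hj⟩ := hshift
  linarith [h.eigenvalues_nonneg j]

/-- If `M - m • 1` is positive semidefinite with `0 ≤ m`, then `det M` is at least
`m` to the dimension. -/
theorem Matrix.IsHermitian.pow_card_le_det_of_posSemidef_sub_smul_one
    {n : Type*} [Fintype n] [DecidableEq n] {M : Matrix n n ℝ} (hM : M.IsHermitian) {m : ℝ}
    (hm : 0 ≤ m) (h : (M - m • (1 : Matrix n n ℝ)).PosSemidef) :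
    m ^ Fintype.card n ≤ M.det := by
  rw [hM.det_eq_prod_eigenvalues, ← Finset.card_univ, ← Finset.prod_const]
  exact Finset.prod_le_prod (fun _ _ => hm)
    fun i _ => hM.le_eigenvalues_of_posSemidef_sub_smul_one h i

/-- coercivity of the integrand of Huang's functional. For `p ≥ 1`,
`θ ∈ (0, 1/2]`, `M` SPD with `M ≥ m̲ I` and `det J ≥ 0`,
`G = θ √(det M) (tr(J M⁻¹ Jᵀ))^{dp/2} + (1−2θ) d^{dp/2} (det M)^{(1−p)/2} (det J)^p`
satisfies `G ≥ θ m̲^{d/2} (tr(J M⁻¹ Jᵀ))^{dp/2}`. -/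
theorem huang_integrand_coercive
    {d : ℕ} (hd : 1 ≤ d)
    (p : ℝ) (hp : 1 ≤ p)
    (θ : ℝ) (hθ0 : 0 < θ) (hθ : θ ≤ 1 / 2)
    (m : ℝ) (hm : 0 < m)
    (M : Matrix (Fin d) (Fin d) ℝ) (hM : M.PosDef)
    (hMm : (M - m • (1 : Matrix (Fin d) (Fin d) ℝ)).PosSemidef)
    (J : Matrix (Fin d) (Fin d) ℝ) (hJ : 0 ≤ J.det) :
    θ * m ^ ((d : ℝ) / 2) * (Matrix.trace (J * M⁻¹ * Jᵀ)) ^ ((d : ℝ) * p / 2)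
      ≤ θ * Real.sqrt M.det * (Matrix.trace (J * M⁻¹ * Jᵀ)) ^ ((d : ℝ) * p / 2)
        + (1 - 2 * θ) * (d : ℝ) ^ ((d : ℝ) * p / 2) * M.det ^ ((1 - p) / 2)
          * J.det ^ p := by
  have htrace : 0 ≤ Matrix.trace (J * M⁻¹ * Jᵀ) :=
    (hM.inv.posSemidef.mul_mul_conjTranspose_same J).trace_nonneg
  have hsqrt : m ^ ((d : ℝ) / 2) ≤ Real.sqrt M.det := by
    have hdet := hM.isHermitian.pow_card_le_det_of_posSemidef_sub_smul_one hm.le hMm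
    rw [Fintype.card_fin] at hdet
    rw [Real.rpow_div_two_eq_sqrt _ hm.le, Real.rpow_natCast]
    refine Real.le_sqrt_of_sq_le ?_
    rwa [← pow_mul, mul_comm, pow_mul, Real.sq_sqrt hm.le]
  have hfirst : θ * m ^ ((d : ℝ) / 2) * (Matrix.trace (J * M⁻¹ * Jᵀ)) ^ ((d : ℝ) * p / 2)
      ≤ θ * Real.sqrt M.det * (Matrix.trace (J * M⁻¹ * Jᵀ)) ^ ((d : ℝ) * p / 2) := by
    gcongr
  have hsecond : 0 ≤ (1 - 2 * θ) * (d : ℝ) ^ ((d : ℝ) * p / 2) * M.det ^ ((1 - p) / 2)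
      * J.det ^ p := by
    have hθ' : 0 ≤ 1 - 2 * θ := by linarith
    have hMdet := hM.det_pos
    positivity
  linarith
end
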